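/- arXiv:2505.08432 — 6 statements merged into one kernel-verified Lean document; each statement's English description precedes it below -/
import Mathlib

section
/- Fix N_t ≥ 1, a unitary matrix U_t ∈ ℂ^{N_t×N_t}, and continuous 1-periodic functions S^{(0)}, …, S^{(N_t−1)} : ℝ → ℝ. For each even N ≥ 2 define the diagonal N_t × N_t matrices C_N(m) := Diag( (1/N) Σ_{l=0}^{N−1} S^{(k)}(l/N) e^{i2π m l/N} )_{k=0,…,N_t−1} and the fading autocorrelation R_N(n, m) := Σ_{p,q=−N/2}^{N/2−1} [U_t C_N(p−q) U_t^H]_{n+m−p N_t, n−q N_t}, where an entry [A]_{a,b} of an N_t × N_t matrix is taken to be 0 whenever a ∉ {0,…,N_t−1} or b ∉ {0,…,N_t−1}. Then for every n, m ∈ ℤ, the limit of R_N(n, m) as even N → ∞ exists and equals Σ_{p,q∈ℤ} ∫_0^1 [U_t Ṡ(λ) U_t^H]_{n+m−p N_t, n−q N_t} e^{i2π(p−q)λ} dλ, where Ṡ(λ) := Diag(S^{(0)}(λ), …, S^{(N_t−1)}(λ)); moreover, for fixed n and m, at most one pair (p, q) contributes a nonzero term to the double sum. -/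
open scoped Matrix

/-- Entry of an `Nt × Nt` matrix with integer indices, taken to be `0` whenever an index
falls outside `{0, …, Nt − 1}`. -/
noncomputable def entE {Nt : ℕ} (A : Matrix (Fin Nt) (Fin Nt) ℂ) (a b : ℤ) : ℂ :=
  if h : 0 ≤ a ∧ a < Nt ∧ 0 ≤ b ∧ b < Nt then
    A ⟨a.toNat, by omega⟩ ⟨b.toNat, by omega⟩
  else 0

/-- The diagonal row-autocorrelation matrix `C_N(m)` with `k`-th entry
`(1/N) ∑_{l<N} S^{(k)}(l/N) e^{i2π m l/N}`. -/
noncomputable def CN {Nt : ℕ} (S : Fin Nt → ℝ → ℝ) (N : ℕ) (m : ℤ) :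
    Matrix (Fin Nt) (Fin Nt) ℂ :=
  Matrix.diagonal fun k => (N : ℂ)⁻¹ * ∑ l ∈ Finset.range N,
    ((S k ((l : ℝ) / (N : ℝ)) : ℝ) : ℂ)
      * Complex.exp (2 * (Real.pi : ℂ) * Complex.I * (m : ℂ) * (l : ℂ) / (N : ℂ))

/-- The fading autocorrelation `R_N(n, m)` of the vectorized spatially stationary
Weichselberger channel (eq. 18). -/
noncomputable def RN {Nt : ℕ} (Ut : Matrix (Fin Nt) (Fin Nt) ℂ) (S : Fin Nt → ℝ → ℝ)
    (N : ℕ) (n m : ℤ) : ℂ :=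
  ∑ p ∈ Finset.Icc (-(N : ℤ) / 2) ((N : ℤ) / 2 - 1),
    ∑ q ∈ Finset.Icc (-(N : ℤ) / 2) ((N : ℤ) / 2 - 1),
      entE (Ut * CN S N (p - q) * Utᴴ) (n + m - p * Nt) (n - q * Nt)

/-- The `(p, q)` term of the limiting autocorrelation (eq. 20),
`∫_0^1 [Uₜ Ṡ(λ) Uₜᴴ]_{n+m−pNt, n−qNt} e^{i2π(p−q)λ} dλ`. -/
noncomputable def limTerm {Nt : ℕ} (Ut : Matrix (Fin Nt) (Fin Nt) ℂ) (S : Fin Nt → ℝ → ℝ)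
    (n m p q : ℤ) : ℂ :=
  ∫ lam in (0:ℝ)..1,
    entE (Ut * Matrix.diagonal (fun k => ((S k lam : ℝ) : ℂ)) * Utᴴ)
        (n + m - p * Nt) (n - q * Nt)
      * Complex.exp (2 * (Real.pi : ℂ) * Complex.I * ((p : ℂ) - (q : ℂ)) * (lam : ℂ))

/-- Left Riemann sums of a continuous function on `[0, 1]` converge to its integral. -/
theorem tendsto_riemannSum_of_continuous {f : ℝ → ℂ} (hf : Continuous f) :
    Filter.Tendsto (fun N : ℕ => (N : ℂ)⁻¹ * ∑ l ∈ Finset.range N, f ((l : ℝ) / (N : ℝ)))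
      Filter.atTop (nhds (∫ x in (0 : ℝ)..1, f x)) := by
  have huc : UniformContinuousOn f (Set.Icc 0 1) :=
    isCompact_Icc.uniformContinuousOn_of_continuous hf.continuousOn
  rw [Metric.uniformContinuousOn_iff] at huc
  rw [Metric.tendsto_atTop]
  intro ε hε
  obtain ⟨δ, hδ, H⟩ := huc (ε / 2) (half_pos hε)
  obtain ⟨N₀, hN₀⟩ := exists_nat_one_div_lt hδ
  refine ⟨N₀ + 1, fun N hN => ?_⟩
  have hNpos : (0 : ℝ) < N := by exact_mod_cast (by omega : 0 < N)
  have hNδ : 1 / (N : ℝ) < δ := by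
    refine lt_of_le_of_lt ?_ hN₀
    apply one_div_le_one_div_of_le (by positivity)
    exact_mod_cast hN
  have hsplit : ∫ x in (0 : ℝ)..1, f x =
      ∑ l ∈ Finset.range N, ∫ x in ((l : ℝ) / N)..(((l + 1 : ℕ) : ℝ) / N), f x := by
    rw [intervalIntegral.sum_integral_adjacent_intervals (a := fun l : ℕ => (l : ℝ) / N)
      fun k _ => hf.intervalIntegrable _ _]
    simp [hNpos.ne']
  have hconst : (N : ℂ)⁻¹ * ∑ l ∈ Finset.range N, f ((l : ℝ) / (N : ℝ)) =
      ∑ l ∈ Finset.range N, ∫ _ in ((l : ℝ) / N)..(((l + 1 : ℕ) : ℝ) / N), f ((l : ℝ) / N) := by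
    rw [Finset.mul_sum]
    refine Finset.sum_congr rfl fun l _ => ?_
    rw [intervalIntegral.integral_const, ← sub_div]
    simp
  rw [hsplit, hconst, dist_eq_norm, ← Finset.sum_sub_distrib]
  refine lt_of_le_of_lt (norm_sum_le_of_le (n := fun _ => ε / 2 * (1 / N)) _ fun l hl => ?_) ?_
  · rw [← intervalIntegral.integral_sub (by simp) (hf.intervalIntegrable _ _)]
    have hlen : ((l + 1 : ℕ) : ℝ) / N = l / N + 1 / N := by push_cast; ring
    have h1N : 0 < 1 / (N : ℝ) := by positivity
    have hle : ((l + 1 : ℕ) : ℝ) / N ≤ 1 := by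
      rw [div_le_one hNpos]
      exact_mod_cast Finset.mem_range.1 hl
    have hl0 : 0 ≤ (l : ℝ) / N := by positivity
    refine (intervalIntegral.norm_integral_le_of_norm_le_const (C := ε / 2)
      fun x hx => ?_).trans_eq ?_
    · rw [Set.uIoc_of_le (by linarith)] at hx
      rw [← dist_eq_norm]
      refine (H _ ⟨hl0, by linarith⟩ _ ⟨by linarith [hx.1], hx.2.trans hle⟩ ?_).le
      rw [dist_comm, Real.dist_eq, abs_of_pos (sub_pos.2 hx.1)]
      linarith [hx.2]
    · rw [hlen, add_sub_cancel_left, abs_of_pos h1N]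
  · rw [Finset.sum_const, Finset.card_range, nsmul_eq_mul]
    field_simp
    linarith

/-- An index inside block `p` of size `d` determines `p`. -/
theorem eq_ediv_of_mem_block {d a p : ℤ} (h0 : 0 ≤ a - p * d) (h1 : a - p * d < d) :
    p = a / d := by
  have hd : 0 < d := h0.trans_lt h1
  symm
  rw [Int.ediv_eq_iff_of_pos hd]
  constructor <;> linarith

theorem entE_eq_zero_of_ne {Nt : ℕ} (A : Matrix (Fin Nt) (Fin Nt) ℂ) {a b p q : ℤ}
    (h : ¬(p = a / Nt ∧ q = b / Nt)) : entE A (a - p * Nt) (b - q * Nt) = 0 :=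
  dif_neg fun ⟨h0, h1, h2, h3⟩ => h ⟨eq_ediv_of_mem_block h0 h1, eq_ediv_of_mem_block h2 h3⟩

/-- The entries of `U D Uᴴ` are fixed linear combinations of the diagonal of `D`. -/
theorem exists_entE_conj_diagonal {Nt : ℕ} (U : Matrix (Fin Nt) (Fin Nt) ℂ) (a b : ℤ) :
    ∃ w : Fin Nt → ℂ, ∀ c : Fin Nt → ℂ,
      entE (U * Matrix.diagonal c * Uᴴ) a b = ∑ k, w k * c k := by
  by_cases h : 0 ≤ a ∧ a < Nt ∧ 0 ≤ b ∧ b < Nt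
  · refine ⟨fun k => U ⟨a.toNat, by omega⟩ k * Uᴴ k ⟨b.toNat, by omega⟩, fun c => ?_⟩
    rw [entE, dif_pos h, Matrix.mul_apply]
    refine Finset.sum_congr rfl fun k _ => ?_
    rw [Matrix.mul_diagonal]
    ring
  · exact ⟨0, fun c => by simp [entE, dif_neg h]⟩

/-- Each block of the fading autocorrelation converges to the corresponding limiting term. -/
theorem tendsto_entE_CN {Nt : ℕ} (Ut : Matrix (Fin Nt) (Fin Nt) ℂ) {S : Fin Nt → ℝ → ℝ}
    (hS : ∀ k, Continuous (S k)) (n m p q : ℤ) :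
    Filter.Tendsto
      (fun N : ℕ => entE (Ut * CN S N (p - q) * Utᴴ) (n + m - p * Nt) (n - q * Nt))
      Filter.atTop (nhds (limTerm Ut S n m p q)) := by
  obtain ⟨w, hw⟩ := exists_entE_conj_diagonal Ut (n + m - p * Nt) (n - q * Nt)
  have hcont : ∀ k, Continuous fun x : ℝ => ((S k x : ℝ) : ℂ) *
      Complex.exp (2 * (Real.pi : ℂ) * Complex.I * ((p : ℂ) - (q : ℂ)) * (x : ℂ)) := fun k => by
    have := hS k
    fun_prop
  have hlim : limTerm Ut S n m p q = ∑ k, w k * ∫ x in (0 : ℝ)..1, ((S k x : ℝ) : ℂ) *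
      Complex.exp (2 * (Real.pi : ℂ) * Complex.I * ((p : ℂ) - (q : ℂ)) * (x : ℂ)) := by
    simp_rw [limTerm, hw, Finset.sum_mul, mul_assoc (w _)]
    rw [intervalIntegral.integral_finsetSum
      fun k _ => ((hcont k).const_mul (w k)).intervalIntegrable _ _]
    simp_rw [intervalIntegral.integral_const_mul]
  simp_rw [hlim, CN, hw]
  refine tendsto_finsetSum _ fun k _ => Filter.Tendsto.const_mul _ ?_
  refine (tendsto_riemannSum_of_continuous (hcont k)).congr fun N => ?_
  push_cast
  simp_rw [mul_div_assoc]

/-- Once the summation range contains the only contributing block, the autocorrelation reduces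
to that block. -/
theorem RN_eq_entE {Nt : ℕ} (Ut : Matrix (Fin Nt) (Fin Nt) ℂ) (S : Fin Nt → ℝ → ℝ) {N : ℕ}
    {n m : ℤ}
    (hp : (n + m) / Nt ∈ Finset.Icc (-(N : ℤ) / 2) ((N : ℤ) / 2 - 1))
    (hq : n / Nt ∈ Finset.Icc (-(N : ℤ) / 2) ((N : ℤ) / 2 - 1)) :
    RN Ut S N n m = entE (Ut * CN S N ((n + m) / Nt - n / Nt) * Utᴴ)
      (n + m - (n + m) / Nt * Nt) (n - n / Nt * Nt) := by
  rw [RN, Finset.sum_eq_single_of_mem _ hp fun p _ h => Finset.sum_eq_zero fun q _ =>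
      entE_eq_zero_of_ne _ fun H => h H.1,
    Finset.sum_eq_single_of_mem _ hq fun q _ h => entE_eq_zero_of_ne _ fun H => h H.2]

theorem limTerm_eq_zero_of_ne {Nt : ℕ} (Ut : Matrix (Fin Nt) (Fin Nt) ℂ) (S : Fin Nt → ℝ → ℝ)
    {n m p q : ℤ} (h : ¬(p = (n + m) / Nt ∧ q = n / Nt)) : limTerm Ut S n m p q = 0 := by
  simp [limTerm, entE_eq_zero_of_ne _ h]

/-- Proposition 2: as the (even) array size `N → ∞`, the fading
autocorrelation `R_N(n,m)` converges to
`∑_{p,q∈ℤ} ∫_0^1 [Uₜ Ṡ(λ) Uₜᴴ]_{n+m−pNt, n−qNt} e^{i2π(p−q)λ} dλ`,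
and for fixed `n, m` at most one pair `(p,q)` contributes a nonzero term. -/
theorem stmt_4 {Nt : ℕ} (hNt : 1 ≤ Nt)
    (Ut : Matrix (Fin Nt) (Fin Nt) ℂ) (hUt : Ut ∈ Matrix.unitaryGroup (Fin Nt) ℂ)
    (S : Fin Nt → ℝ → ℝ) (hScont : ∀ k, Continuous (S k))
    (hSper : ∀ k x, S k (x + 1) = S k x) :
    ∀ n m : ℤ,
      Filter.Tendsto (fun N : ℕ => RN Ut S (2 * (N + 1)) n m) Filter.atTop
        (nhds (∑' p : ℤ, ∑' q : ℤ, limTerm Ut S n m p q))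
      ∧ {pq : ℤ × ℤ | limTerm Ut S n m pq.1 pq.2 ≠ 0}.Subsingleton := by
  intro n m
  constructor
  · rw [tsum_eq_single ((n + m) / (Nt : ℤ)) fun p h => by
        simp [limTerm_eq_zero_of_ne Ut S fun H : p = _ ∧ _ => h H.1],
      tsum_eq_single (n / (Nt : ℤ)) fun q h => limTerm_eq_zero_of_ne Ut S fun H => h H.2]
    have hN : Filter.Tendsto (fun N : ℕ => 2 * (N + 1)) Filter.atTop Filter.atTop :=
      Filter.tendsto_atTop_mono (fun N => show N ≤ _ by omega) Filter.tendsto_id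
    refine ((tendsto_entE_CN Ut hScont n m _ _).comp hN).congr' ?_
    filter_upwards [Filter.eventually_ge_atTop
      (((n + m) / (Nt : ℤ)).natAbs + (n / (Nt : ℤ)).natAbs)] with N h
    refine (RN_eq_entE Ut S ?_ ?_).symm <;> rw [Finset.mem_Icc] <;> push_cast <;> omega
  · intro x hx y hy
    have key : ∀ z : ℤ × ℤ, limTerm Ut S n m z.1 z.2 ≠ 0 → z = ((n + m) / Nt, n / Nt) :=
      fun z hz => Prod.ext_iff.2 (not_not.1 fun h => hz (limTerm_eq_zero_of_ne Ut S h))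
    rw [key x hx, key y hy]
end

section
/- Let K ≥ 1 and let B : [0, 1/K) → ℂ^{K×K} be a measurable family of unitary matrices. For σ ∈ [0, 1/K), k ∈ {0,…,K−1} and n ∈ ℤ define φ(n, σ + k/K) := Σ_{q=0}^{K−1} [B(σ)]_{q,k} e^{i2π n (σ + q/K)} (so that φ(n, ·) is defined on [0,1)). Then the family is orthonormal: for all n, n' ∈ ℤ, ∫_0^1 φ(n, λ) conj(φ(n', λ)) dλ = 1 if n = n' and 0 otherwise. -/
open scoped Matrix

open MeasureTheory in
lemma integral_zero_one_eq_sum_translates {K : ℕ} (hK : 1 ≤ K) {F : ℝ → ℂ}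
    (hF : ∀ k : Fin K, IntervalIntegrable (fun s => F (s + (k : ℕ) / K)) volume 0 (1 / K)) :
    ∫ x in (0:ℝ)..1, F x = ∑ k : Fin K, ∫ s in (0:ℝ)..(1 / K), F (s + (k : ℕ) / K) := by
  have hK0 : (K : ℝ) ≠ 0 := by positivity
  have hend (k : ℕ) : (1 / K + k / K : ℝ) = ((k + 1 : ℕ) : ℝ) / K := by
    push_cast; ring
  have hint : ∀ k < K,
      IntervalIntegrable F volume ((k : ℝ) / K) (((k + 1 : ℕ) : ℝ) / K) := by
    intro k hk
    have h := (hF ⟨k, hk⟩).comp_sub_right ((k : ℝ) / K)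
    simpa only [sub_add_cancel, zero_add, hend] using h
  have h := intervalIntegral.sum_integral_adjacent_intervals (μ := volume) hint
  rw [Nat.cast_zero, zero_div, div_self hK0] at h
  rw [← h, Finset.sum_range]
  refine Finset.sum_congr rfl fun k _ => ?_
  rw [intervalIntegral.integral_comp_add_right, zero_add, hend]

lemma integral_exp_int_zero_one (m : ℤ) :
    ∫ x in (0:ℝ)..1, Complex.exp (2 * (Real.pi : ℂ) * Complex.I * (m : ℂ) * (x : ℂ))
      = if m = 0 then 1 else 0 := by
  split_ifs with hm
  · simp [hm]
  · have hc : 2 * (Real.pi : ℂ) * Complex.I * (m : ℂ) ≠ 0 :=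
      mul_ne_zero Complex.two_pi_I_ne_zero (Int.cast_ne_zero.mpr hm)
    have he : Complex.exp (2 * (Real.pi : ℂ) * Complex.I * (m : ℂ)) = 1 := by
      rw [mul_comm, Complex.exp_int_mul_two_pi_mul_I]
    rw [integral_exp_mul_complex hc]
    simp [he]

lemma sum_mul_conj_of_mem_unitaryGroup {ι : Type*} [Fintype ι] [DecidableEq ι]
    {U : Matrix ι ι ℂ} (hU : U ∈ Matrix.unitaryGroup ι ℂ) (u v : ι → ℂ) :
    ∑ k, (∑ q, U q k * u q) * (starRingEnd ℂ) (∑ q, U q k * v q)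
      = ∑ q, u q * (starRingEnd ℂ) (v q) := by
  have h : (u ᵥ* U) ⬝ᵥ star (v ᵥ* U) = u ⬝ᵥ star v := by
    rw [Matrix.star_vecMul, ← Matrix.dotProduct_mulVec, Matrix.mulVec_mulVec,
      ← Matrix.star_eq_conjTranspose, Matrix.mem_unitaryGroup_iff.mp hU, Matrix.one_mulVec]
  simpa [dotProduct, Matrix.vecMul, mul_comm] using h

lemma exp_int_mul_conj_exp_int (n n' : ℤ) (x : ℝ) :
    Complex.exp (2 * (Real.pi : ℂ) * Complex.I * (n : ℂ) * (x : ℂ))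
        * (starRingEnd ℂ) (Complex.exp (2 * (Real.pi : ℂ) * Complex.I * (n' : ℂ) * (x : ℂ)))
      = Complex.exp (2 * (Real.pi : ℂ) * Complex.I * ((n - n' : ℤ) : ℂ) * (x : ℂ)) := by
  rw [← Complex.exp_conj, ← Complex.exp_add]
  congr 1
  simp only [map_mul, Complex.conj_ofReal, Complex.conj_I, map_intCast, map_ofNat]
  push_cast
  ring

lemma norm_sum_mul_exp_int_le {ι : Type*} [Fintype ι] [DecidableEq ι]
    {U : Matrix ι ι ℂ} (hU : U ∈ Matrix.unitaryGroup ι ℂ) (k : ι) (n : ℤ) (x : ι → ℝ) :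
    ‖∑ q, U q k * Complex.exp (2 * (Real.pi : ℂ) * Complex.I * (n : ℂ) * (x q : ℂ))‖
      ≤ Fintype.card ι := by
  refine (norm_sum_le_of_le (f := fun q => U q k * _) (n := fun _ => (1 : ℝ)) _
    fun q _ => ?_).trans (by simp)
  have he : ‖Complex.exp (2 * (Real.pi : ℂ) * Complex.I * (n : ℂ) * (x q : ℂ))‖ = 1 := by
    simp [Complex.norm_exp]
  rw [norm_mul, he, mul_one]
  exact entry_norm_bound_of_unitary hU q k

/-- eq. 33, orthonormality: the Karhunen–Loève eigenfunctions
`φ(n, σ + k/K) = ∑_q [B(σ)]_{q,k} e^{i2π n (σ + q/K)}`, built from a measurable family of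
unitary matrices `B(σ)`, `σ ∈ [0, 1/K)`, form an orthonormal family on `[0,1]`. -/
theorem stmt_9 (K : ℕ) (hK : 1 ≤ K)
    (B : ℝ → Matrix (Fin K) (Fin K) ℂ)
    (hBmeas : ∀ q k : Fin K, Measurable fun σ => B σ q k)
    (hBunit : ∀ σ ∈ Set.Ico (0:ℝ) (1 / K), B σ ∈ Matrix.unitaryGroup (Fin K) ℂ)
    (φ : ℤ → ℝ → ℂ)
    (hφ : ∀ (n : ℤ) (σ : ℝ), σ ∈ Set.Ico (0:ℝ) (1 / K) → ∀ k : Fin K,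
      φ n (σ + (k : ℕ) / K) = ∑ q : Fin K, B σ q k
        * Complex.exp (2 * (Real.pi : ℂ) * Complex.I * (n : ℂ)
            * ((σ : ℂ) + ((q : ℕ) : ℂ) / (K : ℂ)))) :
    ∀ n n' : ℤ,
      (∫ lam in (0:ℝ)..1, φ n lam * (starRingEnd ℂ) (φ n' lam))
        = if n = n' then 1 else 0 := by
  intro n n'
  set e : ℤ → ℝ → ℂ :=
    fun m x => Complex.exp (2 * (Real.pi : ℂ) * Complex.I * (m : ℂ) * (x : ℂ)) with he
  set S : ℤ → Fin K → ℝ → ℂ :=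
    fun m k σ => ∑ q : Fin K, B σ q k * e m (σ + (q : ℕ) / K) with hS
  have hφS (m : ℤ) (k : Fin K) (σ : ℝ) (hσ : σ ∈ Set.Ico (0:ℝ) (1 / K)) :
      φ m (σ + (k : ℕ) / K) = S m k σ := by
    rw [hφ m σ hσ k]
    simp [hS, he]
  have hle : (0 : ℝ) ≤ 1 / K := by positivity
  have he_cont (m : ℤ) : Continuous (e m) := by fun_prop
  have hS_meas (m : ℤ) (k : Fin K) : Measurable (S m k) :=
    Finset.measurable_fun_sum _ fun q _ =>
      (hBmeas q k).mul ((he_cont m).measurable.comp (measurable_id.add_const _))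
  have hint (k : Fin K) : IntervalIntegrable
      (fun σ => φ n (σ + (k : ℕ) / K) * (starRingEnd ℂ) (φ n' (σ + (k : ℕ) / K)))
      MeasureTheory.volume 0 (1 / K) := by
    rw [intervalIntegrable_iff_integrableOn_Ico_of_le hle]
    have hSint : MeasureTheory.IntegrableOn
        (fun σ => S n k σ * (starRingEnd ℂ) (S n' k σ)) (Set.Ico (0:ℝ) (1 / K)) := by
      refine MeasureTheory.Measure.integrableOn_of_bounded (M := (K : ℝ) * K) (by simp)
        ((hS_meas n k).mul
          (Complex.continuous_conj.measurable.comp (hS_meas n' k))).aestronglyMeasurable ?_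
      filter_upwards [MeasureTheory.ae_restrict_mem measurableSet_Ico] with σ hσ
      have hb (m : ℤ) : ‖S m k σ‖ ≤ K := by
        simpa [hS, he] using norm_sum_mul_exp_int_le (hBunit σ hσ) k m fun q => σ + (q : ℕ) / K
      rw [norm_mul, RCLike.norm_conj]
      exact mul_le_mul (hb n) (hb n') (norm_nonneg _) (Nat.cast_nonneg K)
    refine hSint.congr_fun (fun σ hσ => ?_) measurableSet_Ico
    simp only [hφS _ k σ hσ]
  have he_int (k : Fin K) : IntervalIntegrable
      (fun σ : ℝ => e (n - n') (σ + (k : ℕ) / K)) MeasureTheory.volume 0 (1 / K) :=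
    ((he_cont _).comp (continuous_add_const _)).intervalIntegrable _ _
  calc ∫ lam in (0:ℝ)..1, φ n lam * (starRingEnd ℂ) (φ n' lam)
      = ∫ σ in (0:ℝ)..(1 / K), ∑ k : Fin K,
          φ n (σ + (k : ℕ) / K) * (starRingEnd ℂ) (φ n' (σ + (k : ℕ) / K)) := by
        rw [integral_zero_one_eq_sum_translates hK hint,
          intervalIntegral.integral_finsetSum fun k _ => hint k]
    _ = ∫ σ in (0:ℝ)..(1 / K), ∑ q : Fin K, e (n - n') (σ + (q : ℕ) / K) := by
        simp only [intervalIntegral.integral_of_le hle,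
          ← MeasureTheory.integral_Ico_eq_integral_Ioc]
        refine MeasureTheory.setIntegral_congr_fun measurableSet_Ico fun σ hσ => ?_
        simp only [hφS _ _ σ hσ, hS]
        rw [sum_mul_conj_of_mem_unitaryGroup (hBunit σ hσ)]
        exact Finset.sum_congr rfl fun q _ => exp_int_mul_conj_exp_int n n' _
    _ = ∫ x in (0:ℝ)..1, e (n - n') x := by
        rw [intervalIntegral.integral_finsetSum fun k _ => he_int k,
          integral_zero_one_eq_sum_translates hK he_int]
    _ = if n = n' then 1 else 0 := by
        simp only [he, integral_exp_int_zero_one, sub_eq_zero]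
end

section
/- Let K ≥ 1, w > 0, and let S : ℝ → ℝ≥0 be bounded and measurable with S(Kσ) > 0 for all σ in a subset of [0, 1/K] of positive Lebesgue measure. For ε > 0 define D(ε) := ∫_0^{1/K} ( ε/(w S(Kσ) + ε) − 1 − log( ε/(w S(Kσ) + ε) ) ) dσ. Then D(ε) → +∞ as ε → 0⁺. -/
open MeasureTheory Filter Topology

/-- If `f` is positive on a subset of `s` of positive measure, then it is bounded below by a positive
constant on such a subset. -/
lemma exists_pos_measure_le_of_pos {α : Type*} [MeasurableSpace α] {μ : Measure α} {s : Set α}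
    {f : α → ℝ} (h : 0 < μ {x ∈ s | 0 < f x}) :
    ∃ δ : ℝ, 0 < δ ∧ 0 < μ {x ∈ s | δ ≤ f x} := by
  by_contra! hc
  refine h.ne' (measure_mono_null (t := ⋃ n : ℕ, {x ∈ s | 1 / ((n : ℝ) + 1) ≤ f x}) ?_ ?_)
  · rintro x ⟨hx, hfx⟩
    obtain ⟨n, hn⟩ := exists_nat_one_div_lt hfx
    exact Set.mem_iUnion.2 ⟨n, hx, hn.le⟩
  · exact measure_iUnion_null fun n => le_antisymm (hc _ (by positivity)) zero_le

lemma sub_one_sub_log_nonneg {x : ℝ} (hx : 0 < x) : 0 ≤ x - 1 - Real.log x := by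
  linarith [Real.log_le_sub_one_of_pos hx]

lemma div_add_sub_one_sub_log_le {a c ε : ℝ} (ha : 0 ≤ a) (hac : a ≤ c) (hε : 0 < ε) :
    ε / (a + ε) - 1 - Real.log (ε / (a + ε)) ≤ -Real.log (ε / (c + ε)) := by
  have h1 : ε / (a + ε) ≤ 1 := (div_le_one (by positivity)).2 (by linarith)
  have h2 : Real.log (ε / (c + ε)) ≤ Real.log (ε / (a + ε)) :=
    Real.log_le_log (div_pos hε (by linarith)) (by gcongr)
  linarith

lemma le_div_add_sub_one_sub_log {a d ε : ℝ} (hd : 0 < d) (hda : d ≤ a) (hε : 0 < ε) :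
    -1 - Real.log (ε / d) ≤ ε / (a + ε) - 1 - Real.log (ε / (a + ε)) := by
  have ha : 0 < a + ε := by linarith
  have h1 : 0 < ε / (a + ε) := by positivity
  have h2 : Real.log (ε / (a + ε)) ≤ Real.log (ε / d) :=
    Real.log_le_log h1 (by gcongr; linarith)
  linarith

/-- eq. 66: the Itakura–Saito divergence
`D(ε) = ∫_0^{1/K} ( ε/(wS(Kσ)+ε) − 1 − log(ε/(wS(Kσ)+ε)) ) dσ` diverges to `+∞` as the noise
power `ε → 0⁺`, whenever `w > 0` and `S(K·)` is positive on a set of positive measure. -/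
theorem stmt_11 (K : ℕ) (hK : 1 ≤ K) (w : ℝ) (hw : 0 < w)
    (S : ℝ → ℝ) (hSmeas : Measurable S) (hSnn : ∀ x, 0 ≤ S x)
    (hSbd : ∃ Cb : ℝ, ∀ x, S x ≤ Cb)
    (hpos : 0 < MeasureTheory.volume {σ ∈ Set.Icc (0:ℝ) (1 / K) | 0 < S (K * σ)}) :
    Filter.Tendsto
      (fun ε : ℝ => ∫ σ in (0:ℝ)..(1 / K),
        (ε / (w * S (K * σ) + ε) - 1 - Real.log (ε / (w * S (K * σ) + ε))))
      (nhdsWithin 0 (Set.Ioi 0)) Filter.atTop := by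
  obtain ⟨C, hC⟩ := hSbd
  obtain ⟨δ, hδ, hE⟩ := exists_pos_measure_le_of_pos hpos
  set E : Set ℝ := {σ ∈ Set.Icc (0:ℝ) (1 / K) | δ ≤ S (K * σ)}
  have hS : Measurable fun σ : ℝ => S (K * σ) := by fun_prop
  have hEmeas : MeasurableSet E :=
    measurableSet_Icc.inter (measurableSet_le measurable_const hS)
  have hEsub : E ⊆ Set.Icc (0:ℝ) (1 / K) := fun σ hσ => hσ.1
  have hEtop : volume E ≠ ⊤ := measure_ne_top_of_subset hEsub (by simp)
  have hEreal : 0 < volume.real E := ENNReal.toReal_pos hE.ne' hEtop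
  have hlim : Tendsto (fun ε : ℝ => (-1 - Real.log (ε / (w * δ))) * volume.real E)
      (𝓝[>] 0) atTop := by
    refine Tendsto.atTop_mul_const hEreal ?_
    have h0 : Tendsto (fun ε : ℝ => ε / (w * δ)) (𝓝[>] 0) (𝓝[>] 0) := by
      refine tendsto_nhdsWithin_iff.2 ⟨?_, ?_⟩
      · have : Tendsto (fun ε : ℝ => ε / (w * δ)) (𝓝 0) (𝓝 (0 / (w * δ))) :=
          tendsto_id.div_const _
        rw [zero_div] at this
        exact this.mono_left nhdsWithin_le_nhds
      · filter_upwards [self_mem_nhdsWithin] with ε hε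
        exact div_pos hε (mul_pos hw hδ)
    have h1 := tendsto_neg_atBot_atTop.comp (Real.tendsto_log_nhdsGT_zero.comp h0)
    simpa [sub_eq_add_neg, Function.comp_def] using tendsto_atTop_add_const_left _ (-1 : ℝ) h1
  refine tendsto_atTop_mono' _ ?_ hlim
  filter_upwards [self_mem_nhdsWithin] with ε (hε : 0 < ε)
  have hnn : ∀ σ : ℝ,
      0 ≤ ε / (w * S (K * σ) + ε) - 1 - Real.log (ε / (w * S (K * σ) + ε)) := fun σ =>
    sub_one_sub_log_nonneg (div_pos hε (by have := mul_nonneg hw.le (hSnn (K * σ)); linarith))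
  have hint : IntegrableOn
      (fun σ : ℝ => ε / (w * S (K * σ) + ε) - 1 - Real.log (ε / (w * S (K * σ) + ε)))
      (Set.Icc (0:ℝ) (1 / K)) := by
    refine Measure.integrableOn_of_bounded (M := -Real.log (ε / (w * C + ε))) (by simp)
      (Measurable.aestronglyMeasurable (by fun_prop)) (Eventually.of_forall fun σ => ?_)
    rw [Real.norm_of_nonneg (hnn σ)]
    exact div_add_sub_one_sub_log_le (mul_nonneg hw.le (hSnn _))
      (mul_le_mul_of_nonneg_left (hC _) hw.le) hε
  rw [intervalIntegral.integral_of_le (by positivity), ← integral_Icc_eq_integral_Ioc]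
  refine le_trans ?_ (setIntegral_mono_set hint (Eventually.of_forall hnn)
    (LE.le.eventuallyLE hEsub))
  exact setIntegral_ge_of_const_le_real hEmeas hEtop
    (fun σ hσ => le_div_add_sub_one_sub_log (mul_pos hw hδ)
      (mul_le_mul_of_nonneg_left hσ.2 hw.le) hε) (hint.mono_set hEsub)
end

section
/- Let K ≥ 1, N ≥ 1, weights w_i, w_j : {0,…,N−1} → ℝ with w_i^{(k)} > 0 and w_j^{(k)} > 0 for all k, and bounded measurable functions S^{(0)}, …, S^{(N−1)} : ℝ → ℝ≥0 such that, for each k, S^{(k)}(Kσ) > 0 for almost every σ ∈ [0, 1/K]. For ε > 0 define D(ε) := Σ_{k=0}^{N−1} ∫_0^{1/K} ( ρ_k(σ, ε) − 1 − log ρ_k(σ, ε) ) dσ, where ρ_k(σ, ε) := (w_i^{(k)} S^{(k)}(Kσ) + ε)/(w_j^{(k)} S^{(k)}(Kσ) + ε). Then lim_{ε → 0⁺} D(ε) = (1/K) Σ_{k=0}^{N−1} ( w_i^{(k)}/w_j^{(k)} − 1 − log( w_i^{(k)}/w_j^{(k)} ) ). -/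
/-- The integrand `ρ - 1 - log ρ` at the ratio `ρ = (a s + ε) / (b s + ε)` is bounded uniformly
in `s ≥ 0` and `ε > 0`. -/
lemma abs_ratio_sub_one_sub_log_le {a b s ε : ℝ} (ha : 0 < a) (hb : 0 < b) (hs : 0 ≤ s)
    (hε : 0 < ε) :
    |(a * s + ε) / (b * s + ε) - 1 - Real.log ((a * s + ε) / (b * s + ε))| ≤
      (a / b + 1) + 1 + (|Real.log (a / (a + b))| + |Real.log (a / b + 1)|) := by
  have hden : 0 < b * s + ε := by positivity
  have hnum : 0 < a * s + ε := by positivity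
  have hlow : a / (a + b) ≤ (a * s + ε) / (b * s + ε) := by
    rw [div_le_div_iff₀ (by positivity) hden]
    nlinarith [mul_nonneg (mul_nonneg ha.le ha.le) hs, mul_pos hb hε]
  have hupp : (a * s + ε) / (b * s + ε) ≤ a / b + 1 := by
    rw [div_add_one hb.ne', div_le_div_iff₀ hden hb]
    nlinarith [mul_nonneg (mul_nonneg hb.le hb.le) hs, mul_pos ha hε]
  have hpos : 0 < (a * s + ε) / (b * s + ε) := div_pos hnum hden
  have hlog₁ := Real.log_le_log (by positivity) hlow
  have hlog₂ := Real.log_le_log hpos hupp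
  have h₁ := neg_abs_le (Real.log (a / (a + b)))
  have h₂ := le_abs_self (Real.log (a / b + 1))
  have h₃ := abs_nonneg (Real.log (a / (a + b)))
  have h₄ := abs_nonneg (Real.log (a / b + 1))
  rw [abs_le]
  constructor <;> linarith

/-- Pointwise limit of the integrand as `ε → 0⁺` where the signal `s` does not vanish. -/
lemma tendsto_ratio_sub_one_sub_log {a b s : ℝ} (ha : 0 < a) (hb : 0 < b) (hs : 0 < s) :
    Filter.Tendsto
      (fun ε : ℝ => (a * s + ε) / (b * s + ε) - 1 - Real.log ((a * s + ε) / (b * s + ε)))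
      (nhdsWithin 0 (Set.Ioi 0)) (nhds (a / b - 1 - Real.log (a / b))) := by
  have hb' : b * s + 0 ≠ 0 := by positivity
  have ha' : (a * s + 0) / (b * s + 0) ≠ 0 := by positivity
  have hc : ContinuousAt
      (fun ε : ℝ => (a * s + ε) / (b * s + ε) - 1 - Real.log ((a * s + ε) / (b * s + ε))) 0 := by
    have hq : ContinuousAt (fun ε : ℝ => (a * s + ε) / (b * s + ε)) 0 :=
      ContinuousAt.div (by fun_prop) (by fun_prop) hb'
    exact (hq.sub continuousAt_const).sub (hq.log ha')
  have ht := hc.tendsto.mono_left (nhdsWithin_le_nhds (s := Set.Ioi (0 : ℝ)))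
  simpa only [add_zero, mul_div_mul_right _ _ hs.ne'] using ht

/-- eq. 67: as the noise power `ε → 0⁺`, the asymptotic normalized
Kullback–Leibler divergence between two codewords with the same `N` active sub-bands converges
to `(1/K) ∑_k ( w_i^{(k)}/w_j^{(k)} − 1 − log(w_i^{(k)}/w_j^{(k)}) )`. -/
theorem stmt_12 (K N : ℕ) (hK : 1 ≤ K) (hN : 1 ≤ N)
    (wi wj : Fin N → ℝ) (hwi : ∀ k, 0 < wi k) (hwj : ∀ k, 0 < wj k)
    (S : Fin N → ℝ → ℝ)
    (hSmeas : ∀ k, Measurable (S k))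
    (hSnn : ∀ k x, 0 ≤ S k x)
    (hSbd : ∀ k, ∃ Cb : ℝ, ∀ x, S k x ≤ Cb)
    (hSpos : ∀ k, ∀ᵐ σ ∂MeasureTheory.volume,
      σ ∈ Set.Icc (0:ℝ) (1 / K) → 0 < S k (K * σ)) :
    Filter.Tendsto
      (fun ε : ℝ => ∑ k : Fin N, ∫ σ in (0:ℝ)..(1 / K),
        ((wi k * S k (K * σ) + ε) / (wj k * S k (K * σ) + ε) - 1
          - Real.log ((wi k * S k (K * σ) + ε) / (wj k * S k (K * σ) + ε))))
      (nhdsWithin 0 (Set.Ioi 0))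
      (nhds ((1 / K : ℝ) * ∑ k : Fin N,
        (wi k / wj k - 1 - Real.log (wi k / wj k)))) := by
  rw [Finset.mul_sum]
  refine tendsto_finsetSum _ fun k _ => ?_
  have hconst : (1 / K : ℝ) * (wi k / wj k - 1 - Real.log (wi k / wj k)) =
      ∫ _ in (0 : ℝ)..(1 / K), (wi k / wj k - 1 - Real.log (wi k / wj k)) := by
    rw [intervalIntegral.integral_const, sub_zero, smul_eq_mul]
  rw [hconst]
  refine intervalIntegral.tendsto_integral_filter_of_dominated_convergence
    (fun _ => (wi k / wj k + 1) + 1 +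
      (|Real.log (wi k / (wi k + wj k))| + |Real.log (wi k / wj k + 1)|)) ?_ ?_
    intervalIntegrable_const ?_
  · refine Filter.Eventually.of_forall fun ε => Measurable.aestronglyMeasurable ?_
    have hS : Measurable fun σ : ℝ => S k (K * σ) :=
      (hSmeas k).comp (measurable_const_mul _)
    have hq : Measurable fun σ : ℝ =>
        (wi k * S k (K * σ) + ε) / (wj k * S k (K * σ) + ε) :=
      ((hS.const_mul _).add_const _).div ((hS.const_mul _).add_const _)
    exact (hq.sub_const _).sub hq.log
  · filter_upwards [self_mem_nhdsWithin] with ε hε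
    exact Filter.Eventually.of_forall fun σ _ =>
      abs_ratio_sub_one_sub_log_le (hwi k) (hwj k) (hSnn k _) hε
  · filter_upwards [hSpos k] with σ hσ hmem
    rw [Set.uIoc_of_le (by positivity)] at hmem
    exact tendsto_ratio_sub_one_sub_log (hwi k) (hwj k) (hσ (Set.Ioc_subset_Icc_self hmem))
end

section
/- Let K ≥ 1, N ≥ 1, weights w_i, w_j : {0,…,N−1} → ℝ≥0, and bounded measurable functions S^{(0)}, …, S^{(N−1)} : ℝ → ℝ≥0. For ε > 0 define D(ε) := Σ_{k=0}^{N−1} ∫_0^{1/K} ( ρ_k(σ, ε) − 1 − log ρ_k(σ, ε) ) dσ, where ρ_k(σ, ε) := (w_i^{(k)} S^{(k)}(Kσ) + ε)/(w_j^{(k)} S^{(k)}(Kσ) + ε). Then lim_{ε → ∞} ε² · D(ε) = Σ_{k=0}^{N−1} ( w_i^{(k)} − w_j^{(k)} )² · (1/2) ∫_0^{1/K} ( S^{(k)}(Kσ) )² dσ. -/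
open Filter Topology in
/-- Second-order expansion of `x - 1 - log x` along `x = (a + ε) / (b + ε)` as `ε → ∞`. -/
theorem tendsto_sq_mul_ratio_sub_one_sub_log (a b : ℝ) :
    Tendsto (fun ε : ℝ => ε ^ 2 *
        ((a + ε) / (b + ε) - 1 - Real.log ((a + ε) / (b + ε))))
      atTop (𝓝 ((a - b) ^ 2 * (1 / 2))) := by
  have hden : Tendsto (fun ε : ℝ => b + ε) atTop atTop :=
    tendsto_atTop_add_const_left _ _ tendsto_id
  have hu : Tendsto (fun ε : ℝ => (a - b) / (b + ε)) atTop (𝓝 0) := hden.const_div_atTop _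
  have hεu : Tendsto (fun ε : ℝ => ε * ((a - b) / (b + ε))) atTop (𝓝 (a - b)) := by
    have h : Tendsto (fun ε : ℝ => (a - b) - b * ((a - b) / (b + ε))) atTop (𝓝 (a - b)) := by
      simpa using (hu.const_mul b).const_sub (a - b)
    refine h.congr' ?_
    filter_upwards [hden.eventually_gt_atTop 0] with ε hε
    field_simp
    ring
  have hmain : Tendsto (fun ε : ℝ => (ε * ((a - b) / (b + ε))) ^ 2 * (1 / 2)) atTop
      (𝓝 ((a - b) ^ 2 * (1 / 2))) := (hεu.pow 2).mul_const _
  have hrem : Tendsto (fun ε : ℝ => 2 * ((ε * ((a - b) / (b + ε))) ^ 2 * |(a - b) / (b + ε)|))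
      atTop (𝓝 0) := by
    simpa using ((hεu.pow 2).mul hu.abs).const_mul 2
  refine hmain.congr_dist (squeeze_zero' (Eventually.of_forall fun _ => dist_nonneg) ?_ hrem)
  have hsmall : ∀ᶠ ε : ℝ in atTop, |(a - b) / (b + ε)| < 1 / 2 :=
    (by simpa using hu.abs : Tendsto _ _ (𝓝 (0 : ℝ))).eventually_lt_const (by norm_num)
  filter_upwards [hden.eventually_gt_atTop 0, hsmall] with ε hε hlt
  have hratio : (a + ε) / (b + ε) = 1 + (a - b) / (b + ε) := by
    field_simp
    ring
  rw [hratio]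
  generalize (a - b) / (b + ε) = u at hlt
  have htaylor : |-u + u ^ 2 / 2 + Real.log (1 + u)| ≤ |u| ^ 3 / (1 - |u|) := by
    have h := Real.abs_log_sub_add_sum_range_le (x := -u) (by rw [abs_neg]; linarith) 2
    norm_num [Finset.sum_range_succ] at h
    exact h
  have hcube : |u| ^ 3 / (1 - |u|) ≤ 2 * |u| ^ 3 := by
    rw [div_le_iff₀ (by linarith)]
    nlinarith [pow_nonneg (abs_nonneg u) 3]
  calc dist ((ε * u) ^ 2 * (1 / 2)) (ε ^ 2 * (1 + u - 1 - Real.log (1 + u)))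
      = ε ^ 2 * |-u + u ^ 2 / 2 + Real.log (1 + u)| := by
        rw [Real.dist_eq, ← abs_of_nonneg (sq_nonneg ε), ← abs_mul, abs_of_nonneg (sq_nonneg ε)]
        congr 1
        ring
    _ ≤ ε ^ 2 * (2 * |u| ^ 3) := by gcongr; exact htaylor.trans hcube
    _ = 2 * ((ε * u) ^ 2 * |u|) := by rw [mul_pow, ← sq_abs u]; ring

theorem abs_sq_mul_ratio_sub_one_sub_log_le {a b ε : ℝ} (ha : 0 ≤ a) (hb : 0 ≤ b) (hε : 0 < ε) :
    |ε ^ 2 * ((a + ε) / (b + ε) - 1 - Real.log ((a + ε) / (b + ε)))| ≤ (a - b) ^ 2 := by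
  have ha' : 0 < a + ε := by linarith
  have hb' : 0 < b + ε := by linarith
  have hpos : 0 < (a + ε) / (b + ε) := div_pos ha' hb'
  have hupper := Real.log_le_sub_one_of_pos hpos
  have hlower := Real.one_sub_inv_le_log_of_pos hpos
  rw [abs_of_nonneg (mul_nonneg (sq_nonneg ε) (by linarith))]
  calc ε ^ 2 * ((a + ε) / (b + ε) - 1 - Real.log ((a + ε) / (b + ε)))
      ≤ ε ^ 2 * ((a + ε) / (b + ε) - 1 - (1 - ((a + ε) / (b + ε))⁻¹)) := by gcongr
    _ = ε ^ 2 * (a - b) ^ 2 / ((a + ε) * (b + ε)) := by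
        field_simp
        ring
    _ ≤ (a - b) ^ 2 := by
        rw [div_le_iff₀ (mul_pos ha' hb'), mul_comm]
        gcongr
        nlinarith [mul_nonneg ha hb, mul_nonneg ha hε.le, mul_nonneg hb hε.le]

/-- eq. 68: low-SNR second-order limit: as the noise power `ε → ∞`,
`ε² · D(ε)` converges to `∑_k (w_i^{(k)} − w_j^{(k)})² (1/2) ∫_0^{1/K} (S^{(k)}(Kσ))² dσ`. -/
theorem stmt_13 (K N : ℕ) (hK : 1 ≤ K) (hN : 1 ≤ N)
    (wi wj : Fin N → ℝ) (hwi : ∀ k, 0 ≤ wi k) (hwj : ∀ k, 0 ≤ wj k)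
    (S : Fin N → ℝ → ℝ)
    (hSmeas : ∀ k, Measurable (S k))
    (hSnn : ∀ k x, 0 ≤ S k x)
    (hSbd : ∀ k, ∃ Cb : ℝ, ∀ x, S k x ≤ Cb) :
    Filter.Tendsto
      (fun ε : ℝ => ε ^ 2 * ∑ k : Fin N, ∫ σ in (0:ℝ)..(1 / K),
        ((wi k * S k (K * σ) + ε) / (wj k * S k (K * σ) + ε) - 1
          - Real.log ((wi k * S k (K * σ) + ε) / (wj k * S k (K * σ) + ε))))
      Filter.atTop
      (nhds (∑ k : Fin N, (wi k - wj k) ^ 2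
        * ((1 / 2 : ℝ) * ∫ σ in (0:ℝ)..(1 / K), (S k (K * σ)) ^ 2))) := by
  simp_rw [Finset.mul_sum]
  refine tendsto_finsetSum _ fun k _ => ?_
  obtain ⟨C, hC⟩ := hSbd k
  have hmeas : Measurable fun σ : ℝ => S k (K * σ) := (hSmeas k).comp (measurable_const_mul _)
  simp_rw [← intervalIntegral.integral_const_mul]
  refine intervalIntegral.tendsto_integral_filter_of_dominated_convergence
    (fun _ => (wi k - wj k) ^ 2 * C ^ 2) ?_ ?_ intervalIntegrable_const ?_
  · refine Filter.Eventually.of_forall fun ε => Measurable.aestronglyMeasurable ?_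
    fun_prop
  · filter_upwards [Filter.eventually_gt_atTop 0] with ε hε
    refine Filter.Eventually.of_forall fun σ _ => ?_
    have hS := hSnn k (K * σ)
    calc _ ≤ (wi k * S k (K * σ) - wj k * S k (K * σ)) ^ 2 :=
          abs_sq_mul_ratio_sub_one_sub_log_le (mul_nonneg (hwi k) hS) (mul_nonneg (hwj k) hS) hε
      _ = (wi k - wj k) ^ 2 * S k (K * σ) ^ 2 := by ring
      _ ≤ (wi k - wj k) ^ 2 * C ^ 2 := by gcongr; exact hC _
  · refine Filter.Eventually.of_forall fun σ _ => ?_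
    convert tendsto_sq_mul_ratio_sub_one_sub_log (wi k * S k (K * σ)) (wj k * S k (K * σ)) using 2
    ring
end

section
/- Let n ≥ 1 and let a, b : {0,…,n−1} → ℝ>0 with a nonincreasing (a_0 ≥ a_1 ≥ … ≥ a_{n−1}) and b nondecreasing (b_0 ≤ b_1 ≤ … ≤ b_{n−1}). Define f(x) := x − 1 − log x for x > 0. Then for every permutation π of {0,…,n−1}, Σ_{k=0}^{n−1} f( a_k / b_{π(k)} ) ≤ Σ_{k=0}^{n−1} f( a_k / b_k ). -/
theorem sum_log_div_comp_perm {ι : Type*} [Fintype ι] {a b : ι → ℝ}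
    (ha : ∀ k, a k ≠ 0) (hb : ∀ k, b k ≠ 0) (π : Equiv.Perm ι) :
    ∑ k, Real.log (a k / b (π k)) = ∑ k, Real.log (a k / b k) := by
  simp only [Real.log_div (ha _) (hb _), Finset.sum_sub_distrib]
  rw [Equiv.sum_comp π fun k => Real.log (b k)]

theorem Antitone.sum_div_comp_perm_le_sum_div {ι : Type*} [Fintype ι] [LinearOrder ι]
    {a b : ι → ℝ} (ha : Antitone a) (hb : Monotone b) (hb_pos : ∀ k, 0 < b k)
    (π : Equiv.Perm ι) :
    ∑ k, a k / b (π k) ≤ ∑ k, a k / b k := by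
  have hb_inv : Antitone fun k => (b k)⁻¹ :=
    fun i _ hij => inv_anti₀ (hb_pos i) (hb hij)
  simpa only [div_eq_mul_inv] using (ha.monovary hb_inv).sum_mul_comp_perm_le_sum_mul (σ := π)

/-- power-profile design, Section 4.1: for `f(x) = x − 1 − log x`,
positive sequences `a` nonincreasing and `b` nondecreasing, pairing in opposite orders
maximizes `∑ f(a_k / b_{π(k)})` over all permutations `π`. -/
theorem stmt_14 (n : ℕ) (hn : 1 ≤ n) (a b : Fin n → ℝ)
    (ha_pos : ∀ k, 0 < a k) (hb_pos : ∀ k, 0 < b k)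
    (ha : Antitone a) (hb : Monotone b) :
    ∀ π : Equiv.Perm (Fin n),
      ∑ k : Fin n, (a k / b (π k) - 1 - Real.log (a k / b (π k)))
        ≤ ∑ k : Fin n, (a k / b k - 1 - Real.log (a k / b k)) := by
  intro π
  simp only [Finset.sum_sub_distrib]
  rw [sum_log_div_comp_perm (fun k => (ha_pos k).ne') (fun k => (hb_pos k).ne') π]
  gcongr ?_ - _ - _
  exact ha.sum_div_comp_perm_le_sum_div hb hb_pos π
end
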